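/- Let X and Y be Polish spaces and A, B disjoint analytic subsets of X×Y. Then exactly one of the following holds: (a) there is a pot(Π⁰₁) set D ⊆ X×Y with A ⊆ D and D ∩ B = ∅; (b) there are continuous maps u : 2^ω → X and v : 2^ω → Y such that A₁ ⊆ (u×v)⁻¹(A) and closure(A₁) ∖ A₁ ⊆ (u×v)⁻¹(B). -/

import Mathlib

open Set Topology

abbrev Cantor : Type := ℕ → Bool

/-- `A ⊆ X × Y` is potentially closed (`pot(Π⁰₁)`): there are finer Polish topologies on `X`
and `Y` making `A` closed in the product. -/
def PotClosed {X Y : Type} (tX : TopologicalSpace X) (tY : TopologicalSpace Y)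
    (A : Set (X × Y)) : Prop :=
  ∃ (σ : TopologicalSpace X) (τ : TopologicalSpace Y),
    σ ≤ tX ∧ τ ≤ tY ∧ @PolishSpace X σ ∧ @PolishSpace Y τ ∧
    @IsClosed (X × Y) (@instTopologicalSpaceProd X Y σ τ) A

/-- Membership in the class `D₂(Σ⁰₁)`: difference of two open sets. -/
def D2Sigma01 {Z : Type} (t : TopologicalSpace Z) (A : Set Z) : Prop :=
  ∃ U V : Set Z, @IsOpen Z t U ∧ @IsOpen Z t V ∧ A = U \ V

/-- The rectangular continuous reducibility `A ≤ʳ_c A'`. -/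
def RedRC {X Y X' Y' : Type} (tX : TopologicalSpace X) (tY : TopologicalSpace Y)
    (tX' : TopologicalSpace X') (tY' : TopologicalSpace Y')
    (A : Set (X × Y)) (A' : Set (X' × Y')) : Prop :=
  ∃ (u : X → X') (v : Y → Y'),
    @Continuous X X' tX tX' u ∧ @Continuous Y Y' tY tY' v ∧
    A = (fun p => (u p.1, v p.2)) ⁻¹' A'

/-- `≤ʳ_c` on subsets of `Cantor × Cantor` with the standard topology. -/
def RedC2 (A A' : Set (Cantor × Cantor)) : Prop :=
  RedRC inferInstance inferInstance inferInstance inferInstance A A'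

/-- `A` is `≤ʳ_c`-minimal among non-potentially closed Borel sets. -/
def MinNonPotClosed {X Y : Type} (tX : TopologicalSpace X) (tY : TopologicalSpace Y)
    (A : Set (X × Y)) : Prop :=
  ¬ PotClosed tX tY A ∧
  ∀ (X' Y' : Type) (tX' : TopologicalSpace X') (tY' : TopologicalSpace Y'),
    @PolishSpace X' tX' → @PolishSpace Y' tY' →
    ∀ A' : Set (X' × Y'),
      @MeasurableSet (X' × Y') (@borel (X' × Y') (@instTopologicalSpaceProd X' Y' tX' tY')) A' →
      ¬ PotClosed tX' tY' A' →
      RedRC tX' tY' tX tY A' A → RedRC tX tY tX' tY' A A'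

/-- The Borel reducibility `A ≤_B A'` for square sets. -/
def RedB {Z Z' : Type} (tZ : TopologicalSpace Z) (tZ' : TopologicalSpace Z')
    (A : Set (Z × Z)) (A' : Set (Z' × Z'))  : Prop :=
  ∃ u : Z → Z', @Measurable Z Z' (@borel Z tZ) (@borel Z' tZ') u ∧
    A = (fun p => (u p.1, u p.2)) ⁻¹' A'

/-- `A` is `≤_B`-minimal among non-potentially closed Borel (square) sets. -/
def MinBNonPotClosed {Z : Type} (tZ : TopologicalSpace Z) (A : Set (Z × Z)) : Prop :=
  ¬ PotClosed tZ tZ A ∧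
  ∀ (Z' : Type) (tZ' : TopologicalSpace Z'), @PolishSpace Z' tZ' →
    ∀ A' : Set (Z' × Z'),
      @MeasurableSet (Z' × Z') (@borel (Z' × Z') (@instTopologicalSpaceProd Z' Z' tZ' tZ')) A' →
      ¬ PotClosed tZ' tZ' A' →
      RedB tZ' tZ A' A → RedB tZ tZ' A A'

/-- The graph of the partial function `f` with domain `D`. -/
def graphRel {X : Type} (D : Set X) (f : X → X) : Set (X × X) :=
  {p | p.1 ∈ D ∧ p.2 = f p.1}

/-- `A^f := ⋃ₙ Graph(fₙ)`. -/
def unionGraphs {X : Type} (D : ℕ → Set X) (f : ℕ → X → X) : Set (X × X) :=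
  ⋃ n, graphRel (D n) (f n)

/-- `f` restricted to `D` is a partial homeomorphism with clopen domain and clopen range. -/
def IsPartialHomeo {X : Type} (t : TopologicalSpace X) (D : Set X) (f : X → X) : Prop :=
  @IsClopen X t D ∧ @IsClopen X t (f '' D) ∧ @ContinuousOn X X t t f D ∧
    ∃ g : X → X, @ContinuousOn X X t t g (f '' D) ∧ ∀ x ∈ D, g (f x) = x

/-- A converging situation: a nonempty zero-dimensional perfect Polish space together with
partial homeomorphisms with clopen domains and ranges such that
`Δ(X) = closure(A^f) \ A^f`. -/
def ConvSit (X : Type) (t : TopologicalSpace X) (D : ℕ → Set X) (f : ℕ → X → X) : Prop :=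
  Nonempty X ∧ @PolishSpace X t ∧
  @TopologicalSpace.IsTopologicalBasis X t {s : Set X | @IsClopen X t s} ∧
  @Perfect X t Set.univ ∧
  (∀ n, IsPartialHomeo t (D n) (f n)) ∧
  Set.diagonal X =
    @closure (X × X) (@instTopologicalSpaceProd X X t t) (unionGraphs D f) \ unionGraphs D f

/-- The domain of the restriction `f^B` of the partial map `(D, f)` to a subset `B`. -/
def subD {X : Type} (B : Set X) (D : Set X) (f : X → X) : Set ↥B :=
  {x | (x : X) ∈ D ∧ f (x : X) ∈ B}

/-- The restriction `f^B` of `f` to `B`, as a map of the subtype (junk value outside). -/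
noncomputable def subF {X : Type} (B : Set X) (f : X → X) : ↥B → ↥B :=
  fun x =>
    letI := Classical.dec (f (x : X) ∈ B)
    if h : f (x : X) ∈ B then ⟨f (x : X), h⟩ else x

/-- `A^f ∩ B²`, viewed on the subtype `B`: the union of the graphs of the `f^B_n`'s. -/
def restrGraphs {X : Type} (B : Set X) (D : ℕ → Set X) (f : ℕ → X → X) : Set (↥B × ↥B) :=
  unionGraphs (fun n => subD B (D n) (f n)) (fun n => subF B (f n))

/-- The subspace topology on `B` induced by a topology `t` on `X`. -/
def subTop {X : Type} (t : TopologicalSpace X) (B : Set X) : TopologicalSpace ↥B :=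
  @TopologicalSpace.induced ↥B X Subtype.val t

/-- The natural bijection `ψ : ω → 2^{<ω}` (enumeration by length, then lexicographically):
`ψ(n)` is the binary expansion of `n+1` with its leading one removed. -/
def psiSeq (n : ℕ) : List Bool := ((n + 1).bits.dropLast).reverse

/-- `s_n := ψ(n)0^{n-|ψ(n)|}`, a dense sequence with `|s_n| = n`. -/
def sSeq (n : ℕ) : List Bool := psiSeq n ++ List.replicate (n - (psiSeq n).length) false

/-- The concatenation `sγ` of a finite sequence `s` with `γ ∈ 2^ω`. -/
def catSeq (s : List Bool) (γ : Cantor) : Cantor :=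
  fun i => if h : i < s.length then s.get ⟨i, h⟩ else γ (i - s.length)

/-- `A₁ := {(s_n0γ, s_n1γ) : n ∈ ω, γ ∈ 2^ω}`. -/
def A1 : Set (Cantor × Cantor) :=
  {p | ∃ (n : ℕ) (γ : Cantor),
    p.1 = catSeq (sSeq n ++ [false]) γ ∧ p.2 = catSeq (sSeq n ++ [true]) γ}

/-- `Card(x↾n)`: the number of ones among the first `n` coordinates of `x`. -/
def cardOnes (x : Cantor) (n : ℕ) : ℕ := ∑ i ∈ Finset.range n, (if x i then 1 else 0)

/-- The domain of `f^S_n`: sequences vanishing at `n` whose first `n` coordinates contain a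
number of ones belonging to `S`. -/
def DSdom (S : Set ℕ) (n : ℕ) : Set Cantor := {x | x n = false ∧ cardOnes x n ∈ S}

/-- `f^S_n (s0γ) := s1γ`: flip the `n`-th coordinate to one. -/
def fSfun (n : ℕ) : Cantor → Cantor := fun x => Function.update x n true

/-- `A^S := {(s0γ, s1γ) : s ∈ 2^{<ω}, Card(s) ∈ S, γ ∈ 2^ω} = ⋃ₙ Graph(f^S_n)`. -/
def ASet (S : Set ℕ) : Set (Cantor × Cantor) := unionGraphs (DSdom S) fSfun

/-- Condition (M) on `S ⊆ ω`. -/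
def CondM (S : Set ℕ) : Prop :=
  ∀ p : ℕ, ∃ k : ℕ, ∀ q : ℕ, ∃ c : ℕ, q ≤ c ∧ c ≤ q + k ∧
    (fun m => c + m) '' (S ∩ Set.Iic p) = S ∩ Set.Icc c (c + p)

/-- Condition (H) on `S ⊆ ω`. -/
def CondH (S : Set ℕ) : Prop :=
  ∀ C : Set Cantor, @MeasurableSet Cantor (borel Cantor) C →
    ∀ σ : TopologicalSpace ↥C, σ ≤ subTop inferInstance C →
      ConvSit ↥C σ (fun n => subD C (DSdom S n) (fSfun n)) (fun n => subF C (fSfun n)) →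
      ∀ l p : ℕ, ∃ n : ℕ, l ≤ n ∧ ∃ γ : ↥C, γ ∈ subD C (DSdom S n) (fSfun n) ∧
        (fun m => cardOnes (γ : Cantor) n + m) '' (S ∩ Set.Iic p) =
          S ∩ Set.Icc (cardOnes (γ : Cantor) n) (cardOnes (γ : Cantor) n + p)

/-- Condition (⊥) on a pair `(S, S')`. -/
def CondPerp (S S' : Set ℕ) : Prop :=
  ∃ p : ℕ, ∀ c : ℕ, (fun m => c + m) '' (S ∩ Set.Iic p) ≠ S' ∩ Set.Icc c (c + p)

/-- Condition (⊥⁻¹) on a pair `(S, S')` (stated in `ℤ` to handle subtraction). -/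
def CondPerpInv (S S' : Set ℕ) : Prop :=
  ∃ p : ℕ, ∀ c : ℕ,
    (fun m : ℕ => (c : ℤ) - (m : ℤ)) '' (S ∩ Set.Iic p) ≠
      ((fun n : ℕ => (n : ℤ)) '' S') ∩ Set.Icc ((c : ℤ) - (p : ℤ)) (c : ℤ)

/-- `A⁻¹ := {(y,x) : (x,y) ∈ A}`. -/
def invRel {X : Type} (A : Set (X × X)) : Set (X × X) := {p | (p.2, p.1) ∈ A}

/-- `γ_α`: `γ_α(4n+2ε) = ε` and `γ_α(2n+1) = α(n)`. -/
def gammaSeq (α : Cantor) (k : ℕ) : Bool :=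
  if k % 2 = 1 then α (k / 2) else decide (k % 4 = 2)

/-- `β_α(i) := γ_α((i)₀)` where `(i)₀ = max {m : 2^m ∣ i+1}`, with values in `{0,1} ⊆ ω`. -/
def betaSeq (α : Cantor) (i : ℕ) : ℕ :=
  if gammaSeq α ((i + 1).factorization 2) then 1 else 0

/-- `S_β := {Σ_{i<l} (1 + β(i)) : l ∈ ω}`. -/
def Sbeta (β : ℕ → ℕ) : Set ℕ :=
  {m | ∃ l : ℕ, m = ∑ i ∈ Finset.range l, (1 + β i)}

/-- `s_n` as a function `ℕ → Bool` (with junk value `false` beyond `n`). -/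
def sSeqFn (n : ℕ) (i : ℕ) : Bool := (sSeq n).getD i false

/-- The domain of `f¹_n` (direction `d = true`) or of `(f¹_n)⁻¹` (direction `d = false`):
`x` extends `s_n` and `x(n) = !d`. -/
def step1Dom (n : ℕ) (d : Bool) : Set Cantor :=
  {x | (∀ i, i < n → x i = sSeqFn n i) ∧ x n = !d}

/-- `f¹_n` (if `d = true`) or its inverse (if `d = false`): set the `n`-th coordinate to `d`. -/
def step1Fun (n : ℕ) (d : Bool) : Cantor → Cantor := fun x => Function.update x n d

/-- Domain of `fₙ` (direction `d = true`) or of `fₙ⁻¹` (direction `d = false`). -/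
def stepDom {X : Type} (D : ℕ → Set X) (f : ℕ → X → X) (n : ℕ) (d : Bool) : Set X :=
  if d then D n else f n '' D n

/-- `fₙ` (direction `d = true`) or its inverse `gₙ` (direction `d = false`). -/
def stepFun {X : Type} (f g : ℕ → X → X) (n : ℕ) (d : Bool) : X → X :=
  if d then f n else g n

/-- An acyclic situation (Definition 26), with `g n` the inverse of `f n`. -/
def AcyclicSit (X : Type) (t : TopologicalSpace X) (D : ℕ → Set X) (f g : ℕ → X → X) : Prop :=
  Nonempty X ∧ @PolishSpace X t ∧
  @TopologicalSpace.IsTopologicalBasis X t {s : Set X | @IsClopen X t s} ∧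
  @Perfect X t Set.univ ∧
  (∀ n, IsPartialHomeo t (D n) (f n)) ∧
  (∀ n, ∀ x ∈ D n, g n (f n x) = x) ∧
  Set.diagonal X ⊆
    @closure (X × X) (@instTopologicalSpaceProd X X t t) (unionGraphs D f) \ unionGraphs D f ∧
  (∀ m : ℕ, 1 ≤ m → ∀ (v : ℕ → ℕ) (ε : ℕ → Bool),
    (∀ i, i + 1 < m → v i ≠ v (i + 1) ∨ ε i = ε (i + 1)) →
    ∀ U : Set X, @IsClopen X t U → U.Nonempty →
      ∃ V : Set X, @IsClopen X t V ∧ V.Nonempty ∧ V ⊆ U ∧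
        ∀ x ∈ V, ∀ w : ℕ → X, w 0 = x →
          (∀ i, i < m → w i ∈ stepDom D f (v i) (ε i) ∧
            w (i + 1) = stepFun f g (v i) (ε i) (w i)) →
          w m ∉ V)

/-- The relation `ℜ_Θ` on `2^{<ω}`: `e ℜ_Θ e'` iff `e = e'` or
`(e, e') = (θ_n0w, θ_n1w)` for some `n` and `w`. -/
def RTheta (θ : ℕ → List Bool) (e e' : List Bool) : Prop :=
  e = e' ∨ ∃ (n : ℕ) (w : List Bool), e = θ n ++ false :: w ∧ e' = θ n ++ true :: w

/-- The symmetrization `s(ℜ_Θ)`. -/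
def sRTheta (θ : ℕ → List Bool) (e e' : List Bool) : Prop :=
  RTheta θ e e' ∨ RTheta θ e' e

/-! ### The dense sequence and the set `A1` -/

theorem length_psiSeq_le (n : ℕ) : (psiSeq n).length ≤ n := by
  have h : (n + 1).size ≤ n + 1 := Nat.size_le.2 Nat.lt_two_pow_self
  simp only [psiSeq, List.length_reverse, List.length_dropLast, Nat.size_eq_bits_len]
  omega

@[simp]
theorem length_sSeq (n : ℕ) : (sSeq n).length = n := by
  have := length_psiSeq_le n
  simp only [sSeq, List.length_append, List.length_replicate]
  omega

theorem exists_bits_eq_append_true (l : List Bool) : ∃ n : ℕ, (n + 1).bits = l ++ [true] := by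
  induction l with
  | nil => exact ⟨0, Nat.one_bits⟩
  | cons b l ih =>
    obtain ⟨n, hn⟩ := ih
    refine ⟨Nat.bit b (n + 1) - 1, ?_⟩
    have h : Nat.bit b (n + 1) - 1 + 1 = Nat.bit b (n + 1) := by
      cases b <;> simp only [Nat.bit_false, Nat.bit_true] <;> omega
    rw [h, Nat.bits_append_bit _ _ (by simp), hn, List.cons_append]

theorem psiSeq_surjective : Function.Surjective psiSeq := by
  intro l
  obtain ⟨n, hn⟩ := exists_bits_eq_append_true l.reverse
  exact ⟨n, by simp [psiSeq, hn]⟩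

theorem exists_sSeqFn_eq (x : Cantor) (m : ℕ) : ∃ n, m ≤ n ∧ ∀ i < m, sSeqFn n i = x i := by
  obtain ⟨n, hn⟩ := psiSeq_surjective (List.ofFn fun i : Fin m => x i)
  have hm : m ≤ n := by simpa [hn] using length_psiSeq_le n
  refine ⟨n, hm, fun i hi => ?_⟩
  simp [sSeqFn, sSeq, hn, List.getD_eq_getElem?_getD, List.getElem?_append, hi]

theorem catSeq_sSeq_apply (n : ℕ) (b : Bool) (γ : Cantor) (i : ℕ) :
    catSeq (sSeq n ++ [b]) γ i =
      if i < n then sSeqFn n i else if i = n then b else γ (i - (n + 1)) := by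
  unfold catSeq sSeqFn
  rcases lt_trichotomy i n with h | rfl | h
  · simp [h, h.trans n.lt_succ_self]
  · simp
  · simp [h.not_gt, h.ne', show ¬ i < n + 1 by omega]

theorem mem_A1_iff {p : Cantor × Cantor} :
    p ∈ A1 ↔ ∃ n, (∀ i < n, p.1 i = sSeqFn n i) ∧ p.1 n = false ∧
      p.2 = Function.update p.1 n true := by
  constructor
  · rintro ⟨n, γ, h₁, h₂⟩
    refine ⟨n, fun i hi => by simp [h₁, catSeq_sSeq_apply, hi],
      by simp [h₁, catSeq_sSeq_apply], ?_⟩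
    funext i
    rcases eq_or_ne i n with rfl | hi
    · simp [h₂, catSeq_sSeq_apply]
    · simp [h₁, h₂, catSeq_sSeq_apply, hi]
  · rintro ⟨n, h, hn, h₂⟩
    have h₁ : p.1 = catSeq (sSeq n ++ [false]) fun i => p.1 (i + (n + 1)) := by
      funext i
      rw [catSeq_sSeq_apply]
      split_ifs with hi hi'
      · exact h i hi
      · rw [hi', hn]
      · exact congrArg p.1 (by omega)
    refine ⟨n, _, h₁, ?_⟩
    rw [h₂]
    funext i
    rcases eq_or_ne i n with rfl | hi
    · simp [catSeq_sSeq_apply]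
    · have := congrFun h₁ i
      rw [catSeq_sSeq_apply] at this
      simp only [Function.update_of_ne hi, this, catSeq_sSeq_apply, hi, if_false]

theorem closure_A1_diff_subset_diagonal : closure A1 \ A1 ⊆ diagonal Cantor := by
  rintro ⟨x, y⟩ ⟨hcl, hA⟩
  by_contra hxy
  obtain ⟨j, hj⟩ := Function.ne_iff.1 (show x ≠ y from hxy)
  have hj₁ : Continuous fun p : Cantor × Cantor => p.1 j := by fun_prop
  have hj₂ : Continuous fun p : Cantor × Cantor => p.2 j := by fun_prop
  have ho : IsOpen {p : Cantor × Cantor | p.1 j ≠ p.2 j} := isOpen_ne_fun hj₁ hj₂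
  set T : Set (Cantor × Cantor) := {p | (∀ i < j, p.1 i = sSeqFn j i) ∧ p.1 j = false ∧
      p.2 = Function.update p.1 j true} with hT
  have hTc : IsClosed T := by
    simp only [hT, ofPred_and, ofPred_forall]
    refine (isClosed_iInter fun i => isClosed_iInter fun _ => ?_).inter
      (IsClosed.inter ?_ ?_)
    · exact isClosed_eq (by fun_prop) continuous_const
    · exact isClosed_eq hj₁ continuous_const
    · exact isClosed_eq continuous_snd (continuous_fst.update j continuous_const)
  have hsub : {p : Cantor × Cantor | p.1 j ≠ p.2 j} ∩ A1 ⊆ T := by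
    rintro p ⟨hp, hpA⟩
    obtain ⟨n, h₁, h₂, h₃⟩ := mem_A1_iff.1 hpA
    obtain rfl : j = n := by
      by_contra hjn
      exact hp (by rw [h₃, Function.update_of_ne hjn])
    exact ⟨h₁, h₂, h₃⟩
  have hmem : (x, y) ∈ T := closure_minimal hsub hTc (ho.inter_closure ⟨hj, hcl⟩)
  exact hA (mem_A1_iff.2 ⟨j, hmem⟩)

theorem diagonal_subset_closure_A1_diff : diagonal Cantor ⊆ closure A1 \ A1 := by
  rintro ⟨x, y⟩ hxy
  obtain rfl : x = y := hxy
  constructor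
  · choose n hmn hn using exists_sSeqFn_eq x
    have key (b : Bool) : Filter.Tendsto
        (fun m => catSeq (sSeq (n m) ++ [b]) fun _ => false) Filter.atTop (𝓝 x) := by
      refine tendsto_pi_nhds.2 fun i => tendsto_const_nhds.congr' ?_
      filter_upwards [Filter.eventually_gt_atTop i] with m hm
      rw [catSeq_sSeq_apply, if_pos (hm.trans_le (hmn m)), hn m i hm]
    exact mem_closure_of_tendsto ((key false).prodMk_nhds (key true))
      (Filter.Eventually.of_forall fun m => ⟨n m, fun _ => false, rfl, rfl⟩)
  · intro h
    obtain ⟨n, -, h₁, h₂⟩ := mem_A1_iff.1 h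
    have := congrFun h₂ n
    simp_all

/-- Flipping one coordinate, as a homeomorphism of the Cantor space. -/
def flipAt (n : ℕ) : Cantor ≃ₜ Cantor where
  toFun x := Function.update x n (!x n)
  invFun x := Function.update x n (!x n)
  left_inv x := by simp
  right_inv x := by simp
  continuous_toFun := continuous_id.update n (by fun_prop)
  continuous_invFun := continuous_id.update n (by fun_prop)

theorem exists_mem_A1_of_not_isMeagre {C : Set Cantor} (hC : BaireMeasurableSet C)
    (hne : ¬ IsMeagre C) : ∃ x ∈ C, ∃ y ∈ C, (x, y) ∈ A1 := by
  obtain ⟨U, hU, hCU⟩ := hC.residualEq_isOpen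
  have hG : {x | x ∈ U → x ∈ C} ∈ residual Cantor := by
    filter_upwards [hCU] with x hx hxU
    exact hx.mpr hxU
  obtain ⟨x, hx⟩ : U.Nonempty := by
    by_contra hU'
    rw [not_nonempty_iff_eq_empty] at hU'
    refine hne ?_
    have : Cᶜ ∈ residual Cantor := by
      filter_upwards [hCU] with x hx hxC
      have : x ∈ U := hx.mp hxC
      simp [hU'] at this
    exact this
  obtain ⟨I, t, ht, hsub⟩ := isOpen_pi_iff.1 hU x hx
  obtain ⟨n, hIn, hn⟩ := exists_sSeqFn_eq x (I.sup id + 1)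
  have hI (i : ℕ) (hi : i ∈ I) : i < I.sup id + 1 := Nat.lt_succ_of_le (I.le_sup (f := id) hi)
  have hVU (y : Cantor) (hy : ∀ i < n, y i = sSeqFn n i) : y ∈ U := by
    refine hsub fun i hi => ?_
    rw [hy i ((hI i hi).trans_le hIn), hn i (hI i hi)]
    exact (ht i hi).2
  set V : Set Cantor := {y | (∀ i < n, y i = sSeqFn n i) ∧ y n = false} with hV
  have hVo : IsOpen V := by
    have : V = (⋂ i ∈ Set.Iio n, {y : Cantor | y i = sSeqFn n i}) ∩ {y | y n = false} := by
      ext; simp [hV]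
    rw [this]
    refine ((Set.finite_Iio n).isOpen_biInter fun i _ => ?_).inter ?_
    · exact (isOpen_discrete {sSeqFn n i}).preimage (f := fun y : Cantor => y i) (continuous_apply i)
    · exact (isOpen_discrete {false}).preimage (f := fun y : Cantor => y n) (continuous_apply n)
  have hVne : V.Nonempty :=
    ⟨catSeq (sSeq n ++ [false]) fun _ => false, fun i hi => by simp [catSeq_sSeq_apply, hi],
      by simp [catSeq_sSeq_apply]⟩
  have hG' := tendsto_residual_of_isOpenMap (flipAt n).continuous (flipAt n).isOpenMap hG
  obtain ⟨y, hyV, hy₁, hy₂⟩ :=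
    (dense_of_mem_residual (Filter.inter_mem hG hG')).inter_open_nonempty V hVo hVne
  have hflip : flipAt n y = Function.update y n true := by simp [flipAt, hyV.2]
  refine ⟨y, hy₁ (hVU y hyV.1), flipAt n y, hy₂ (hVU _ fun i hi => ?_),
    mem_A1_iff.2 ⟨n, hyV.1, hyV.2, hflip⟩⟩
  rw [hflip, Function.update_of_ne hi.ne, hyV.1 i hi]

/-! ### Countable unions of Borel rectangles -/

/-- `E` is a countable union of Borel rectangles that are disjoint from `A`. -/
def IsRectUnionAvoiding {X Y : Type} [MeasurableSpace X] [MeasurableSpace Y]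
    (A E : Set (X × Y)) : Prop :=
  ∃ 𝒞 : Set (Set X × Set Y), 𝒞.Countable ∧
    (∀ R ∈ 𝒞, MeasurableSet R.1 ∧ MeasurableSet R.2 ∧ Disjoint (R.1 ×ˢ R.2) A) ∧
    E = ⋃ R ∈ 𝒞, R.1 ×ˢ R.2

namespace IsRectUnionAvoiding

variable {X Y : Type} [MeasurableSpace X] [MeasurableSpace Y] {A E : Set (X × Y)}

theorem measurableSet (h : IsRectUnionAvoiding A E) : MeasurableSet E := by
  obtain ⟨𝒞, hc, h𝒞, rfl⟩ := h
  exact MeasurableSet.biUnion hc fun R hR => (h𝒞 R hR).1.prod (h𝒞 R hR).2.1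

theorem disjoint (h : IsRectUnionAvoiding A E) : Disjoint E A := by
  obtain ⟨𝒞, -, h𝒞, rfl⟩ := h
  exact disjoint_iUnion₂_left.2 fun R hR => (h𝒞 R hR).2.2

theorem iUnion {ι : Type*} [Countable ι] {E : ι → Set (X × Y)}
    (h : ∀ i, IsRectUnionAvoiding A (E i)) : IsRectUnionAvoiding A (⋃ i, E i) := by
  choose 𝒞 hc h𝒞 hE using h
  refine ⟨⋃ i, 𝒞 i, countable_iUnion hc, fun R hR => ?_, ?_⟩
  · obtain ⟨i, hi⟩ := mem_iUnion.1 hR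
    exact h𝒞 i R hi
  · simp only [hE, biUnion_iUnion]

theorem of_prod {P : Set X} {Q : Set Y} (hP : MeasurableSet P) (hQ : MeasurableSet Q)
    (h : Disjoint (P ×ˢ Q) A) : IsRectUnionAvoiding A (P ×ˢ Q) :=
  ⟨{(P, Q)}, countable_singleton _, by simp [hP, hQ, h], by simp⟩

theorem union {F : Set (X × Y)} (hE : IsRectUnionAvoiding A E) (hF : IsRectUnionAvoiding A F) :
    IsRectUnionAvoiding A (E ∪ F) := by
  rw [union_eq_iUnion]
  exact iUnion (Bool.forall_bool.2 ⟨hF, hE⟩)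

end IsRectUnionAvoiding

theorem exists_polishSpace_le_forall_isOpen {X : Type} [tX : TopologicalSpace X] [PolishSpace X]
    [MeasurableSpace X] [BorelSpace X] {𝒮 : Set (Set X)} (hc : 𝒮.Countable)
    (h𝒮 : ∀ s ∈ 𝒮, MeasurableSet s) :
    ∃ σ : TopologicalSpace X, σ ≤ tX ∧ @PolishSpace X σ ∧ ∀ s ∈ 𝒮, IsOpen[σ] s := by
  have := hc.to_subtype
  choose t ht ht' _ hto using fun s : 𝒮 => (h𝒮 s s.2).isClopenable
  obtain ⟨σ, hσ, hle, hσ'⟩ := PolishSpace.exists_polishSpace_forall_le t ht ht'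
  exact ⟨σ, hle, hσ', fun s hs => hσ ⟨s, hs⟩ _ (hto ⟨s, hs⟩)⟩

theorem IsRectUnionAvoiding.potClosed_compl {X Y : Type} [tX : TopologicalSpace X]
    [tY : TopologicalSpace Y] [PolishSpace X] [PolishSpace Y] [MeasurableSpace X] [BorelSpace X]
    [MeasurableSpace Y] [BorelSpace Y] {A E : Set (X × Y)} (h : IsRectUnionAvoiding A E) :
    PotClosed tX tY Eᶜ := by
  obtain ⟨𝒞, hc, h𝒞, rfl⟩ := h
  obtain ⟨σ, hσ, hσ', hσo⟩ := exists_polishSpace_le_forall_isOpen (hc.image Prod.fst)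
    (forall_mem_image.2 fun R hR => (h𝒞 R hR).1)
  obtain ⟨τ, hτ, hτ', hτo⟩ := exists_polishSpace_le_forall_isOpen (hc.image Prod.snd)
    (forall_mem_image.2 fun R hR => (h𝒞 R hR).2.1)
  refine ⟨σ, τ, hσ, hτ, hσ', hτ', ?_⟩
  rw [isClosed_compl_iff]
  exact isOpen_biUnion fun R hR =>
    (hσo _ (mem_image_of_mem _ hR)).prod (hτo _ (mem_image_of_mem _ hR))

theorem PotClosed.exists_compl_eq_iUnion_prod {X Y : Type} [tX : TopologicalSpace X]
    [tY : TopologicalSpace Y] [hX : PolishSpace X] [hY : PolishSpace Y]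
    [MeasurableSpace X] [BorelSpace X] [MeasurableSpace Y] [BorelSpace Y]
    {D : Set (X × Y)} (h : PotClosed tX tY D) :
    ∃ 𝒞 : Set (Set X × Set Y), 𝒞.Countable ∧
      (∀ R ∈ 𝒞, MeasurableSet R.1 ∧ MeasurableSet R.2) ∧ Dᶜ = ⋃ R ∈ 𝒞, R.1 ×ˢ R.2 := by
  have hmX := BorelSpace.measurable_eq (α := X)
  have hmY := BorelSpace.measurable_eq (α := Y)
  obtain ⟨σ, τ, hσ, hτ, hσ', hτ', hD⟩ := h
  have hσb : @borel X σ = @borel X tX := MeasureTheory.borel_eq_borel_of_le hσ' hX hσ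
  have hτb : @borel Y τ = @borel Y tY := MeasureTheory.borel_eq_borel_of_le hτ' hY hτ
  have hbX := @TopologicalSpace.isBasis_countableBasis X σ hσ'.toSecondCountableTopology
  have hbY := @TopologicalSpace.isBasis_countableBasis Y τ hτ'.toSecondCountableTopology
  have hcX := @TopologicalSpace.countable_countableBasis X σ hσ'.toSecondCountableTopology
  have hcY := @TopologicalSpace.countable_countableBasis Y τ hτ'.toSecondCountableTopology
  set bX := @TopologicalSpace.countableBasis X σ hσ'.toSecondCountableTopology
  set bY := @TopologicalSpace.countableBasis Y τ hτ'.toSecondCountableTopology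
  have hbXm (s : Set X) (hs : s ∈ bX) : MeasurableSet s := by
    rw [hmX, ← hσb]
    exact MeasurableSpace.measurableSet_generateFrom (hbX.isOpen hs)
  have hbYm (s : Set Y) (hs : s ∈ bY) : MeasurableSet s := by
    rw [hmY, ← hτb]
    exact MeasurableSpace.measurableSet_generateFrom (hbY.isOpen hs)
  refine ⟨{R | R ∈ bX ×ˢ bY ∧ R.1 ×ˢ R.2 ⊆ Dᶜ}, (hcX.prod hcY).mono fun R hR => hR.1,
    fun R hR => ⟨hbXm _ hR.1.1, hbYm _ hR.1.2⟩, Subset.antisymm (fun p hp => ?_)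
      (iUnion₂_subset fun R hR => hR.2)⟩
  obtain ⟨_, ⟨P, hP, Q, hQ, rfl⟩, hpR, hR⟩ :=
    (hbX.prod hbY).exists_subset_of_mem_open hp hD.isOpen_compl
  exact mem_biUnion (x := (P, Q)) ⟨⟨hP, hQ⟩, hR⟩ hpR

theorem MeasureTheory.AnalyticSet.inter {α : Type*} [TopologicalSpace α] [T2Space α] {s t : Set α}
    (hs : AnalyticSet s) (ht : AnalyticSet t) : AnalyticSet (s ∩ t) := by
  rw [inter_eq_iInter]
  exact AnalyticSet.iInter (Bool.forall_bool.2 ⟨ht, hs⟩)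

theorem exists_measurableSet_prod_of_analyticSet {X Y : Type} [TopologicalSpace X]
    [TopologicalSpace Y] [PolishSpace X] [PolishSpace Y] [MeasurableSpace X] [BorelSpace X]
    [MeasurableSpace Y] [BorelSpace Y] {A : Set (X × Y)} (hA : MeasureTheory.AnalyticSet A)
    {P : Set X} {Q : Set Y} (hP : MeasureTheory.AnalyticSet P) (hQ : MeasureTheory.AnalyticSet Q)
    (h : Disjoint (P ×ˢ Q) A) :
    ∃ P' Q', P ⊆ P' ∧ Q ⊆ Q' ∧ MeasurableSet P' ∧ MeasurableSet Q' ∧ Disjoint (P' ×ˢ Q') A := by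
  rw [disjoint_left] at h
  obtain ⟨P', hPP', hP'd, hP'⟩ := hP.measurablySeparable
    ((hA.inter (hQ.preimage continuous_snd)).image_of_continuous continuous_fst) <| by
      rw [disjoint_left]
      rintro x hx ⟨⟨_, y⟩, ⟨hxy, hy⟩, rfl⟩
      exact h ⟨hx, hy⟩ hxy
  rw [disjoint_left] at hP'd
  obtain ⟨Q', hQQ', hQ'd, hQ'⟩ := hQ.measurablySeparable
    ((hA.inter (hP'.analyticSet.preimage continuous_fst)).image_of_continuous continuous_snd) <| by
      rw [disjoint_left]
      rintro y hy ⟨⟨x, _⟩, ⟨hxy, hx⟩, rfl⟩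
      exact hP'd ⟨(x, _), ⟨hxy, hy⟩, rfl⟩ hx
  rw [disjoint_left] at hQ'd
  refine ⟨P', Q', hPP', hQQ', hP', hQ', disjoint_left.2 ?_⟩
  rintro ⟨x, y⟩ ⟨hx, hy⟩ hxy
  exact hQ'd ⟨(x, y), ⟨hxy, hx⟩, rfl⟩ hy

theorem PotClosed.not_of_continuous {X Y : Type} [tX : TopologicalSpace X]
    [tY : TopologicalSpace Y] [PolishSpace X] [PolishSpace Y] {A B D : Set (X × Y)}
    (hD : PotClosed tX tY D) (hAD : A ⊆ D) (hDB : D ∩ B = ∅) {u : Cantor → X} {v : Cantor → Y}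
    (hu : Continuous u) (hv : Continuous v)
    (hA : A1 ⊆ (fun p : Cantor × Cantor => (u p.1, v p.2)) ⁻¹' A)
    (hB : closure A1 \ A1 ⊆ (fun p : Cantor × Cantor => (u p.1, v p.2)) ⁻¹' B) : False := by
  borelize X Y
  obtain ⟨𝒞, hc, h𝒞, hDc⟩ := hD.exists_compl_eq_iUnion_prod
  have hcover (x : Cantor) : ∃ R ∈ 𝒞, u x ∈ R.1 ∧ v x ∈ R.2 := by
    have hxB : (u x, v x) ∈ B := hB (diagonal_subset_closure_A1_diff (mem_diagonal x))
    have hxD : (u x, v x) ∈ Dᶜ := fun hxD =>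
      notMem_empty _ (hDB.subset ⟨hxD, hxB⟩)
    rw [hDc] at hxD
    obtain ⟨R, hR, hx⟩ := mem_iUnion₂.1 hxD
    exact ⟨R, hR, hx⟩
  have hex : ∃ R ∈ 𝒞, ¬ IsMeagre (u ⁻¹' R.1 ∩ v ⁻¹' R.2) := by
    by_contra! hall
    have := hc.to_subtype
    have hM : IsMeagre (⋃ R : 𝒞, u ⁻¹' R.1.1 ∩ v ⁻¹' R.1.2) :=
      isMeagre_iUnion fun R => hall R R.2
    refine not_isMeagre_of_isOpen (isOpen_univ (X := Cantor)) univ_nonempty (hM.mono fun x _ => ?_)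
    obtain ⟨R, hR, hx⟩ := hcover x
    exact mem_iUnion.2 ⟨⟨R, hR⟩, hx⟩
  obtain ⟨R, hR, hRm⟩ := hex
  borelize Cantor
  have hmeas : MeasurableSet (u ⁻¹' R.1 ∩ v ⁻¹' R.2) :=
    (hu.measurable (h𝒞 R hR).1).inter (hv.measurable (h𝒞 R hR).2)
  obtain ⟨x, hx, y, hy, hxy⟩ := exists_mem_A1_of_not_isMeagre hmeas.baireMeasurableSet hRm
  have hmem : (u x, v y) ∈ Dᶜ := hDc ▸ mem_biUnion hR ⟨hx.1, hy.2⟩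
  exact hmem (hAD (hA hxy))

/-! ### Large families of configurations -/

/-- A configuration of level `n` is stored in a single function on finite sequences, written
backwards: the sequences of length `n` carry the vertices, those of length `n - k - 1` carry the
edges labelled by `sSeq k`. Only the values at sequences of length at most `n` matter. -/
abbrev Config : Type := List Bool → ℕ → ℕ

/-- The configuration of level `n` below `w` consisting of the sequences that end in `b`. -/
def Config.child (b : Bool) (w : Config) : Config := fun t => w (b :: t)

theorem Config.continuous_child (b : Bool) : Continuous (Config.child b) :=
  continuous_pi fun t => continuous_apply (b :: t)

/-- The configuration with given children and given value at the empty sequence. -/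
def Config.join (w : Bool → Config) (γ : ℕ → ℕ) : Config
  | [] => γ
  | b :: t => w b t

/-- The one-step amalgamation of a set of configurations of level `n`: both children belong to
the set, and the value at the empty sequence witnesses the new edge between them. -/
def amalgamation {X Y : Type} (f g : (ℕ → ℕ) → X × Y) (n : ℕ) (S : Set Config) : Set Config :=
  {w | w.child false ∈ S ∧ w.child true ∈ S ∧
    g (w []) = ((f (w (false :: (sSeq n).reverse))).1, (f (w (true :: (sSeq n).reverse))).2)}

theorem analyticSet_amalgamation {X Y : Type} [TopologicalSpace X] [TopologicalSpace Y] [T2Space X]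
    [T2Space Y] {f g : (ℕ → ℕ) → X × Y} (hf : Continuous f) (hg : Continuous g) {n : ℕ}
    {S : Set Config} (hS : MeasureTheory.AnalyticSet S) :
    MeasureTheory.AnalyticSet (amalgamation f g n S) := by
  refine (hS.preimage (Config.continuous_child false)).inter
    ((hS.preimage (Config.continuous_child true)).inter (IsClosed.analyticSet ?_))
  exact isClosed_eq (by fun_prop) (by fun_prop)

section Large

variable {X Y : Type} [MeasurableSpace X] [MeasurableSpace Y]

/-- A set of configurations of level `n` is large if no countable union of Borel rectangles
avoiding `A` meets the `f`-images of the vertices of each of them. -/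
def IsLarge (A : Set (X × Y)) (f : (ℕ → ℕ) → X × Y) (n : ℕ) (S : Set Config) : Prop :=
  ∀ E, IsRectUnionAvoiding A E → ∃ w ∈ S, ∀ t : List Bool, t.length = n → f (w t) ∉ E

variable {A : Set (X × Y)} {f g : (ℕ → ℕ) → X × Y} {n : ℕ} {S : Set Config}

theorem IsLarge.exists_inter_fiber (hS : IsLarge A f n S) {ι : Type*} [Countable ι]
    (h : Config → ι) : ∃ i, IsLarge A f n (S ∩ h ⁻¹' {i}) := by
  by_contra! hall
  simp only [IsLarge, not_forall, not_exists, not_and] at hall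
  choose E hE hall using hall
  obtain ⟨w, hw, hwE⟩ := hS _ (IsRectUnionAvoiding.iUnion hE)
  obtain ⟨t, ht, hmem⟩ : ∃ t : List Bool, t.length = n ∧ f (w t) ∈ E (h w) := by
    simpa using hall (h w) w ⟨hw, rfl⟩
  exact hwE t ht (mem_iUnion.2 ⟨_, hmem⟩)

theorem IsLarge.exists_refinement (hSa : MeasureTheory.AnalyticSet S) (hS : IsLarge A f n S) :
    ∃ S' ⊆ S, MeasureTheory.AnalyticSet S' ∧ IsLarge A f n S' ∧
      ∀ w ∈ S', ∀ w' ∈ S', ∀ t : List Bool, t.length ≤ n → ∀ i < n, w t i = w' t i := by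
  have : Finite {t : List Bool // t.length ≤ n} := (List.finite_length_le Bool n).to_subtype
  let h : Config → {t : List Bool // t.length ≤ n} → Fin n → ℕ := fun w t i => w t i
  have hh : Continuous h := by fun_prop
  obtain ⟨a, ha⟩ := hS.exists_inter_fiber h
  refine ⟨_, inter_subset_left,
    hSa.inter ((isClosed_singleton.preimage hh).analyticSet), ha, ?_⟩
  intro w hw w' hw' t ht i hi
  exact congrFun (congrFun (hw.2.trans hw'.2.symm) ⟨t, ht⟩) ⟨i, hi⟩

variable [TopologicalSpace X] [TopologicalSpace Y] [PolishSpace X] [PolishSpace Y]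
  [BorelSpace X] [BorelSpace Y]

theorem IsLarge.amalgamation (hA : MeasureTheory.AnalyticSet A) (hgA : A ⊆ range g)
    (hf : Continuous f) (hSa : MeasureTheory.AnalyticSet S) (hS : IsLarge A f n S) :
    IsLarge A f (n + 1) (amalgamation f g n S) := by
  intro E hE
  set T : Set Config := S ∩ {w | ∀ t : List Bool, t.length = n → f (w t) ∉ E} with hT
  have hTa : MeasureTheory.AnalyticSet T := by
    borelize Config
    refine hSa.inter (MeasurableSet.analyticSet ?_)
    simp only [ofPred_forall]
    refine MeasurableSet.iInter fun t => MeasurableSet.iInter fun _ => ?_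
    have hft : Continuous fun w : Config => f (w t) := by fun_prop
    exact (hft.measurable hE.measurableSet).compl
  set r := (sSeq n).reverse
  have hr : r.length = n := by simp [r]
  have hcr : Continuous fun w : Config => f (w r) := by fun_prop
  obtain ⟨w₀, hw₀, w₁, hw₁, hmem⟩ :
      ∃ w₀ ∈ T, ∃ w₁ ∈ T, ((f (w₀ r)).1, (f (w₁ r)).2) ∈ A := by
    by_contra! hnot
    obtain ⟨P, Q, hP, hQ, hPm, hQm, hd⟩ := exists_measurableSet_prod_of_analyticSet hA
      (hTa.image_of_continuous (continuous_fst.comp hcr))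
      (hTa.image_of_continuous (continuous_snd.comp hcr)) <| by
        rw [disjoint_left]
        rintro ⟨_, _⟩ ⟨⟨w₀, hw₀, rfl⟩, ⟨w₁, hw₁, rfl⟩⟩
        exact hnot w₀ hw₀ w₁ hw₁
    obtain ⟨w, hw, hwE⟩ := hS _ (hE.union (.of_prod hPm hQm hd))
    have hwT : w ∈ T := ⟨hw, fun t ht htE => hwE t ht (Or.inl htE)⟩
    exact hwE r hr (Or.inr ⟨hP ⟨w, hwT, rfl⟩, hQ ⟨w, hwT, rfl⟩⟩)
  obtain ⟨γ, hγ⟩ := hgA hmem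
  refine ⟨Config.join (fun b => cond b w₁ w₀) γ, ⟨hw₀.1, hw₁.1, hγ⟩, fun t ht => ?_⟩
  match t, ht with
  | false :: t, ht => exact hw₀.2 t (by simpa using ht)
  | true :: t, ht => exact hw₁.2 t (by simpa using ht)

theorem exists_seq_of_isLarge_univ (hA : MeasureTheory.AnalyticSet A) (hgA : A ⊆ range g)
    (hf : Continuous f) (hg : Continuous g) (h : IsLarge A f 0 univ) :
    ∃ S : ℕ → Set Config, (∀ n, (S n).Nonempty) ∧ (∀ n, S (n + 1) ⊆ amalgamation f g n (S n)) ∧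
      ∀ n, ∀ w ∈ S n, ∀ w' ∈ S n, ∀ t : List Bool, t.length ≤ n → ∀ i < n, w t i = w' t i := by
  let T (n : ℕ) := {S : Set Config // MeasureTheory.AnalyticSet S ∧ IsLarge A f n S ∧
    ∀ w ∈ S, ∀ w' ∈ S, ∀ t : List Bool, t.length ≤ n → ∀ i < n, w t i = w' t i}
  have hstep (n : ℕ) (S : T n) : ∃ S' : T (n + 1), S'.1 ⊆ amalgamation f g n S.1 := by
    obtain ⟨S', hS', h'⟩ := (S.2.2.1.amalgamation hA hgA hf S.2.1).exists_refinement
      (analyticSet_amalgamation hf hg S.2.1)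
    exact ⟨⟨S', h'⟩, hS'⟩
  choose next hnext using hstep
  let S : (n : ℕ) → T n :=
    fun n => Nat.rec ⟨univ, isClosed_univ.analyticSet, h, by simp⟩ next n
  refine ⟨fun n => (S n).1, fun n => ?_, fun n => hnext n (S n), fun n => (S n).2.2.2⟩
  obtain ⟨w, hw, -⟩ := (S n).2.2.1 ∅ ⟨∅, countable_empty, by simp, by simp⟩
  exact ⟨w, hw⟩

end Large

/-! ### Passing to the limit -/

/-- The initial segment of length `n` of `x`, written backwards. -/
def revTake (x : Cantor) : ℕ → List Bool
  | 0 => []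
  | n + 1 => x n :: revTake x n

@[simp]
theorem length_revTake (x : Cantor) (n : ℕ) : (revTake x n).length = n := by
  induction n with
  | zero => rfl
  | succ n ih => simp [revTake, ih]

theorem isLocallyConstant_revTake (n : ℕ) :
    IsLocallyConstant fun x : Cantor => revTake x n := by
  induction n with
  | zero => exact IsLocallyConstant.const []
  | succ n ih =>
    exact ((IsLocallyConstant.iff_continuous _).2 (continuous_apply n)).comp₂ ih List.cons

theorem revTake_catSeq_length (s : List Bool) (γ : Cantor) {j : ℕ} (hj : j ≤ s.length) :
    revTake (catSeq s γ) j = (s.take j).reverse := by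
  induction j with
  | zero => simp [revTake]
  | succ j ih =>
    have hj' : j < s.length := hj
    rw [revTake, ih hj'.le, List.take_succ_eq_append_getElem hj', List.reverse_append]
    simp [catSeq, hj']

theorem revTake_catSeq (s : List Bool) (γ : Cantor) (n : ℕ) :
    revTake (catSeq s γ) (n + s.length) = revTake γ n ++ s.reverse := by
  induction n with
  | zero => simp [revTake_catSeq_length, revTake]
  | succ n ih => rw [Nat.add_right_comm, revTake, ih]; simp [revTake, catSeq]

/-- The limit along `x` of the values of the configurations `w (n + c)` at `revTake x n`. -/
def limitMap (w : ℕ → Config) (c : ℕ) (x : Cantor) : ℕ → ℕ :=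
  fun m => w (m + 1 + c) (revTake x (m + 1)) m

theorem continuous_limitMap (w : ℕ → Config) (c : ℕ) : Continuous (limitMap w c) :=
  continuous_pi fun m =>
    ((isLocallyConstant_revTake (m + 1)).comp fun t => w (m + 1 + c) t m).continuous

theorem tendsto_limitMap {w : ℕ → Config}
    (hw : ∀ n b, ∀ t : List Bool, t.length ≤ n → ∀ i < n, w (n + 1) (b :: t) i = w n t i)
    (c : ℕ) (x : Cantor) :
    Filter.Tendsto (fun n => w (n + c) (revTake x n)) Filter.atTop (𝓝 (limitMap w c x)) := by
  refine tendsto_pi_nhds.2 fun m => tendsto_const_nhds.congr' ?_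
  filter_upwards [Filter.eventually_ge_atTop (m + 1)] with n hn
  induction n, hn using Nat.le_induction with
  | base => rfl
  | succ n hn ih =>
    rw [ih, Nat.add_right_comm, revTake, hw _ _ _ (by simp) _ (by omega)]

theorem edge_of_mem {X Y : Type} {f g : (ℕ → ℕ) → X × Y} {S : ℕ → Set Config}
    (hS : ∀ n, S (n + 1) ⊆ amalgamation f g n (S n)) (k : ℕ) (t : List Bool) {w : Config}
    (hw : w ∈ S (t.length + (k + 1))) :
    g (w t) = ((f (w (t ++ false :: (sSeq k).reverse))).1,
      (f (w (t ++ true :: (sSeq k).reverse))).2) := by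
  induction t generalizing w with
  | nil =>
    rw [List.length_nil, Nat.zero_add] at hw
    exact (hS k hw).2.2
  | cons b t ih =>
    have hw' : w ∈ amalgamation f g _ (S (t.length + (k + 1))) :=
      hS _ (by rwa [List.length_cons, Nat.add_right_comm] at hw)
    have hb : w.child b ∈ S (t.length + (k + 1)) := by
      cases b
      exacts [hw'.1, hw'.2.1]
    exact ih hb

theorem exists_continuous_of_seq {X Y : Type} [TopologicalSpace X] [TopologicalSpace Y]
    [T2Space X] [T2Space Y] {f g : (ℕ → ℕ) → X × Y} (hf : Continuous f) (hg : Continuous g)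
    {S : ℕ → Set Config} (hne : ∀ n, (S n).Nonempty)
    (hS : ∀ n, S (n + 1) ⊆ amalgamation f g n (S n))
    (hagree : ∀ n, ∀ w ∈ S n, ∀ w' ∈ S n, ∀ t : List Bool, t.length ≤ n →
      ∀ i < n, w t i = w' t i) :
    ∃ φ : Cantor → ℕ → ℕ, Continuous φ ∧
      ∀ p ∈ A1, ((f (φ p.1)).1, (f (φ p.2)).2) ∈ range g := by
  choose w hwS using hne
  have hw (n : ℕ) (b : Bool) (t : List Bool) (ht : t.length ≤ n) (i : ℕ) (hi : i < n) :
      w (n + 1) (b :: t) i = w n t i := by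
    have hmem : (w (n + 1)).child b ∈ S n := by
      cases b
      exacts [(hS n (hwS _)).1, (hS n (hwS _)).2.1]
    exact hagree n _ hmem _ (hwS n) t ht i hi
  refine ⟨limitMap w 0, continuous_limitMap w 0, ?_⟩
  rintro ⟨_, _⟩ ⟨k, γ, rfl, rfl⟩
  refine ⟨limitMap w (k + 1) γ, ?_⟩
  have hvertex (b : Bool) : Filter.Tendsto
      (fun n => w (n + (k + 1)) (revTake γ n ++ b :: (sSeq k).reverse)) Filter.atTop
      (𝓝 (limitMap w 0 (catSeq (sSeq k ++ [b]) γ))) := by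
    refine ((tendsto_limitMap hw 0 (catSeq (sSeq k ++ [b]) γ)).comp
      (Filter.tendsto_add_atTop_nat (k + 1))).congr fun n => ?_
    have := revTake_catSeq (sSeq k ++ [b]) γ n
    simp only [List.length_append, length_sSeq, List.length_singleton, List.reverse_append,
      List.reverse_singleton, List.singleton_append] at this
    simp only [Function.comp_apply, this, Nat.add_zero]
  have hedge := (hg.tendsto _).comp (tendsto_limitMap hw (k + 1) γ)
  refine tendsto_nhds_unique hedge
    (((((continuous_fst.comp hf).tendsto _).comp (hvertex false)).prodMk_nhds
      (((continuous_snd.comp hf).tendsto _).comp (hvertex true))).congr fun n => ?_)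
  exact (edge_of_mem hS k (revTake γ n) (by simpa using hwS (n + (k + 1)))).symm

theorem exists_potClosed_or_exists_continuous {X Y : Type} [tX : TopologicalSpace X]
    [tY : TopologicalSpace Y] [PolishSpace X] [PolishSpace Y] {A B : Set (X × Y)}
    (hA : MeasureTheory.AnalyticSet A) (hB : MeasureTheory.AnalyticSet B) :
    (∃ D : Set (X × Y), PotClosed tX tY D ∧ A ⊆ D ∧ D ∩ B = ∅) ∨
      ∃ (u : Cantor → X) (v : Cantor → Y), Continuous u ∧ Continuous v ∧
        A1 ⊆ (fun p : Cantor × Cantor => (u p.1, v p.2)) ⁻¹' A ∧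
        closure A1 \ A1 ⊆ (fun p : Cantor × Cantor => (u p.1, v p.2)) ⁻¹' B := by
  borelize X Y
  by_cases hsep : ∃ E, IsRectUnionAvoiding A E ∧ B ⊆ E
  · obtain ⟨E, hE, hBE⟩ := hsep
    exact Or.inl ⟨Eᶜ, hE.potClosed_compl, subset_compl_iff_disjoint_left.2 hE.disjoint,
      (disjoint_compl_left_iff_subset.2 hBE).inter_eq⟩
  push Not at hsep
  right
  have hB' := hB
  rw [MeasureTheory.AnalyticSet] at hB'
  rcases hB' with rfl | ⟨f, hf, rfl⟩
  · exact absurd (empty_subset _)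
      (hsep ∅ ⟨∅, countable_empty, by simp, by simp⟩)
  have hlarge : IsLarge A f 0 univ := by
    intro E hE
    obtain ⟨_, ⟨z, rfl⟩, hz⟩ := not_subset.1 (hsep E hE)
    exact ⟨fun _ => z, mem_univ _, fun _ _ => hz⟩
  have hA' := hA
  rw [MeasureTheory.AnalyticSet] at hA'
  rcases hA' with rfl | ⟨g, hg, rfl⟩
  · refine absurd (subset_univ _) (hsep univ ?_)
    rw [← univ_prod_univ]
    exact .of_prod .univ .univ (disjoint_empty _)
  obtain ⟨S, hne, hS, hagree⟩ := exists_seq_of_isLarge_univ hA subset_rfl hf hg hlarge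
  obtain ⟨φ, hφ, hφA⟩ := exists_continuous_of_seq hf hg hne hS hagree
  refine ⟨fun x => (f (φ x)).1, fun x => (f (φ x)).2, by fun_prop, by fun_prop, hφA, ?_⟩
  intro p hp
  obtain ⟨x, y⟩ := p
  obtain rfl : x = y := closure_A1_diff_subset_diagonal hp
  exact ⟨φ x, rfl⟩

theorem stmt0 {X Y : Type} [tX : TopologicalSpace X] [tY : TopologicalSpace Y]
    [PolishSpace X] [PolishSpace Y] (A B : Set (X × Y))
    (hA : MeasureTheory.AnalyticSet A) (hB : MeasureTheory.AnalyticSet B)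
    (hdisj : Disjoint A B) :
    Xor'
      (∃ D : Set (X × Y), PotClosed tX tY D ∧ A ⊆ D ∧ D ∩ B = ∅)
      (∃ (u : Cantor → X) (v : Cantor → Y), Continuous u ∧ Continuous v ∧
        A1 ⊆ (fun p : Cantor × Cantor => (u p.1, v p.2)) ⁻¹' A ∧
        closure A1 \ A1 ⊆ (fun p : Cantor × Cantor => (u p.1, v p.2)) ⁻¹' B) := by
  rcases exists_potClosed_or_exists_continuous hA hB with h | h
  · refine Or.inl ⟨h, ?_⟩
    rintro ⟨u, v, hu, hv, hu₁, hv₁⟩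
    obtain ⟨D, hD, hAD, hDB⟩ := h
    exact hD.not_of_continuous hAD hDB hu hv hu₁ hv₁
  · refine Or.inr ⟨h, ?_⟩
    rintro ⟨D, hD, hAD, hDB⟩
    obtain ⟨u, v, hu, hv, hu₁, hv₁⟩ := h
    exact hD.not_of_continuous hAD hDB hu hv hu₁ hv₁
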